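/- Let (Λ_Q, f) be a C^{1+Lip} expansive and transitive Markov system. Let x ∈ Λ_Q be a periodic point with f^m(x) = x, and let y ∈ Λ_Q be any point with f^j(y) = x for some j ≥ 0. Then y ∈ H if and only if |(f^m)'(x)| > 1 (equivalently, if and only if χ(x) > 0). -/

import Mathlib

open Set Metric Filter MeasureTheory
open scoped Classical

/-- The word `[ω 0, ω 1, …, ω (n-1)]` read off from the sequence `ω`. -/
def wordOf {p : ℕ} (ω : ℕ → Fin p) (n : ℕ) : List (Fin p) :=
  (List.range n).map ω

/-- The cylinder sets `Δ_{i₁…iₙ} = g_{i₁…i_{n-1}}(I_{iₙ})` of the iterated function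
system given by the big interval `I`, the subintervals `Isub i` and the maps `g i`;
by convention `Δ_∅ = I`. -/
def cylOf {p : ℕ} (I : Set ℝ) (Isub : Fin p → Set ℝ) (g : Fin p → ℝ → ℝ) :
    List (Fin p) → Set ℝ
  | [] => I
  | [i] => Isub i
  | i :: j :: w => g i '' cylOf I Isub g (j :: w)

/-- The sequence `ω` contains the word `w` as a sub-word starting at position `n`. -/
def containsAt {p : ℕ} (ω : ℕ → Fin p) (w : List (Fin p)) (n : ℕ) : Prop :=
  ∀ k : ℕ, (hk : k < w.length) → ω (n + k) = w.get ⟨k, hk⟩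

/-- The sequence `ω` belongs to `Σ_Q`, i.e. it contains no word of `Q` as a sub-word. -/
def avoids {p : ℕ} (Q : Finset (List (Fin p))) (ω : ℕ → Fin p) : Prop :=
  ∀ w ∈ Q, ∀ n : ℕ, ¬ containsAt ω w n

/-- The limit set `Λ_Q = π(Σ_Q)`: points lying, for some `ω ∈ Σ_Q`, in all the
cylinders `Δ_{ω₀…ω_{n-1}}`. -/
def limitSetOf {p : ℕ} (I : Set ℝ) (Isub : Fin p → Set ℝ) (g : Fin p → ℝ → ℝ)
    (Q : Finset (List (Fin p))) : Set ℝ :=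
  { x | ∃ ω : ℕ → Fin p, avoids Q ω ∧ ∀ n : ℕ, x ∈ cylOf I Isub g (wordOf ω n) }

/-- `gIter g ω n = g_{i_n … i_1} = g_{ω (n-1)} ∘ ⋯ ∘ g_{ω 0}`. -/
def gIter {p : ℕ} (g : Fin p → ℝ → ℝ) (ω : ℕ → Fin p) : ℕ → ℝ → ℝ
  | 0 => id
  | n + 1 => g (ω n) ∘ gIter g ω n

/-- The derivative of the composition `gIter g ω n` at `x` (chain rule product). -/
noncomputable def gIterDer {p : ℕ} (g gder : Fin p → ℝ → ℝ) (ω : ℕ → Fin p)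
    (n : ℕ) (x : ℝ) : ℝ :=
  ∏ k ∈ Finset.range n, gder (ω k) (gIter g ω k x)

/-- Prepending the finite word `w` to the infinite sequence `ω`. -/
def prependWord {p : ℕ} (w : List (Fin p)) (ω : ℕ → Fin p) : ℕ → Fin p :=
  fun n => if h : n < w.length then w.get ⟨n, h⟩ else ω (n - w.length)

/-- `l(Σ_Q)`: the minimum, over all finite sets `Q'` of words with `Σ_{Q'} = Σ_Q`,
of the maximal length `l(Q')` of words of `Q'`. -/
noncomputable def minRepLen {p : ℕ} (Q : Finset (List (Fin p))) : ℕ :=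
  sInf { n : ℕ | ∃ Q' : Finset (List (Fin p)),
    (∀ ω : ℕ → Fin p, avoids Q' ω ↔ avoids Q ω) ∧ Q'.sup List.length = n }

/-- A `C^{1+Lip}` expansive and transitive Markov system `(Λ_Q, f)`. -/
structure ExpansiveMarkovSystem (p : ℕ) where
  /-- the alphabet is nonempty -/
  hp : 0 < p
  /-- the ambient closed interval `I` -/
  I : Set ℝ
  hI : ∃ a b : ℝ, a < b ∧ I = Set.Icc a b
  /-- the pairwise disjoint closed subintervals `I₁, …, I_p` -/
  Isub : Fin p → Set ℝ
  hIsub : ∀ i, ∃ a b : ℝ, a < b ∧ Isub i = Set.Icc a b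
  hsubI : ∀ i, Isub i ⊆ I
  hdisj : ∀ i j, i ≠ j → Disjoint (Isub i) (Isub j)
  /-- the contractions `g i`, defined on `⋃ j, Isub j` -/
  g : Fin p → ℝ → ℝ
  /-- the derivative of `g i` on `⋃ j, Isub j` -/
  gder : Fin p → ℝ → ℝ
  hg_inj : ∀ i, Set.InjOn (g i) (⋃ j, Isub j)
  hg_range : ∀ i, g i '' (⋃ j, Isub j) ⊆ interior (Isub i)
  hg_deriv : ∀ i, ∀ x ∈ ⋃ j, Isub j,
    HasDerivWithinAt (g i) (gder i x) (⋃ j, Isub j) x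
  hgder_ne : ∀ i, ∀ x ∈ ⋃ j, Isub j, gder i x ≠ 0
  hgder_cont : ∀ i, ContinuousOn (gder i) (⋃ j, Isub j)
  /-- `log |g i'|` is Lipschitz on the domain -/
  hgder_lip : ∀ i, ∃ θ : ℝ, ∀ x ∈ ⋃ j, Isub j, ∀ y ∈ ⋃ j, Isub j,
    abs (Real.log (abs (gder i x)) - Real.log (abs (gder i y))) ≤ θ * |x - y|
  /-- the expanding map `f`, with `f (g i x) = x` -/
  f : ℝ → ℝ
  /-- the derivative `f'` of `f` on the ranges of the `g i` -/
  fder : ℝ → ℝ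
  hf : ∀ i, ∀ x ∈ ⋃ j, Isub j, f (g i x) = x
  hfder : ∀ i, ∀ x ∈ ⋃ j, Isub j, fder (g i x) = (gder i x)⁻¹
  /-- the generator (expansivity) condition: `d_n → 0` -/
  hgen : ∀ ε : ℝ, 0 < ε → ∃ N : ℕ, ∀ w : List (Fin p), N ≤ w.length →
    Metric.diam (cylOf I Isub g w) < ε
  /-- the finite set of forbidden words -/
  Q : Finset (List (Fin p))
  /-- `Σ_Q` is completely invariant: `σ(Σ_Q) = Σ_Q` -/
  hQinv : ∀ ω : ℕ → Fin p, avoids Q ω →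
    ∃ ω' : ℕ → Fin p, avoids Q ω' ∧ ∀ n : ℕ, ω' (n + 1) = ω n
  /-- `f|Λ_Q` is topologically transitive -/
  htrans : ∀ U V : Set ℝ, IsOpen U → IsOpen V →
    (U ∩ limitSetOf I Isub g Q).Nonempty → (V ∩ limitSetOf I Isub g Q).Nonempty →
    ∃ n : ℕ, ∃ x ∈ U ∩ limitSetOf I Isub g Q, f^[n] x ∈ V

namespace ExpansiveMarkovSystem

variable {p : ℕ} (S : ExpansiveMarkovSystem p)

/-- The common domain `⋃ j, I_j` of the maps `g i`. -/
def dom : Set ℝ := ⋃ j, S.Isub j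

/-- The cylinder `Δ_w` associated to the word `w`. -/
def cyl (w : List (Fin p)) : Set ℝ := cylOf S.I S.Isub S.g w

/-- The limit set `Λ_Q`. -/
def limitSet : Set ℝ := limitSetOf S.I S.Isub S.g S.Q

/-- The domain of `f`, i.e. the union of the ranges of the `g i`. -/
def domF : Set ℝ := ⋃ i, S.g i '' S.dom

/-- The derivative `(fⁿ)'(x)` of the `n`-th iterate of `f` at `x`. -/
noncomputable def derIter (n : ℕ) (x : ℝ) : ℝ :=
  ∏ k ∈ Finset.range n, S.fder (S.f^[k] x)

/-- The Lyapunov exponent `χ(x) = limsup (1/n) log |(fⁿ)'(x)|`. -/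
noncomputable def lyap (x : ℝ) : ℝ :=
  Filter.limsup (fun n : ℕ => Real.log |S.derIter n x| / n) Filter.atTop

/-- The set `H` of points of `Λ_Q` with infinitely many hyperbolic instants. -/
def hypSet : Set ℝ :=
  { x ∈ S.limitSet | ∃ c₁ : ℝ, 0 < c₁ ∧ ∃ c₂ : ℝ, 0 < c₂ ∧
      ∃ n : ℕ → ℕ, StrictMono n ∧
        ∃ r : ℕ → ℝ, (∀ k, 0 < r k) ∧ Antitone r ∧
          Filter.Tendsto r Filter.atTop (nhds 0) ∧
          ∀ k : ℕ,
            (∀ y ∈ Metric.ball x (r k), ∀ j < n k, S.f^[j] y ∈ S.domF) ∧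
            c₁ < Metric.diam (S.f^[n k] '' Metric.ball x (r k)) ∧
            (∀ y ∈ Metric.ball x (r k), ∀ z ∈ Metric.ball x (r k),
              |S.derIter (n k) y| / |S.derIter (n k) z| < c₂) }

/-- `x` is a parabolic periodic point: `f^m(x) = x` and `|(f^m)'(x)| = 1`. -/
def IsParabolicPeriodic (x : ℝ) : Prop :=
  x ∈ S.limitSet ∧ ∃ m : ℕ, 1 ≤ m ∧ S.f^[m] x = x ∧ |S.derIter m x| = 1

/-- `ν` is a `t`-conformal (Borel probability) measure supported on `Λ_Q`. -/
def IsConformal (ν : Measure ℝ) (t : ℝ) : Prop :=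
  IsProbabilityMeasure ν ∧ ν S.limitSetᶜ = 0 ∧
    ∀ A : Set ℝ, MeasurableSet A → A ⊆ S.limitSet → Set.InjOn S.f A →
      ν (S.f '' A) = ∫⁻ x in A, ENNReal.ofReal (|S.fder x| ^ t) ∂ν

/-- `t_c = inf {t ≥ 0 : a t-conformal measure on Λ_Q exists}`. -/
noncomputable def tc : ℝ :=
  sInf { t : ℝ | 0 ≤ t ∧ ∃ ν : Measure ℝ, S.IsConformal ν t }

/-- `n` is a hyperbolic time for `x` with exponent `α`. -/
def IsHypTime (α : ℝ) (x : ℝ) (n : ℕ) : Prop :=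
  ∀ k : ℕ, 1 ≤ k → k ≤ n → Real.exp (k * α) ≤ |S.derIter k (S.f^[n - k] x)|

/-- `H_HT(α)`: the points of `Λ_Q` with infinitely many hyperbolic times with exponent `α`. -/
def HHT (α : ℝ) : Set ℝ :=
  { x ∈ S.limitSet | ∀ N : ℕ, ∃ n : ℕ, N ≤ n ∧ S.IsHypTime α x n }

end ExpansiveMarkovSystem

namespace ExpansiveMarkovSystem

variable {p : ℕ} (S : ExpansiveMarkovSystem p)

lemma isCompact_dom : IsCompact S.dom := by
  refine isCompact_iUnion fun i => ?_
  obtain ⟨a, b, -, h⟩ := S.hIsub i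
  rw [h]
  exact isCompact_Icc

lemma continuousOn_g (i : Fin p) : ContinuousOn (S.g i) S.dom :=
  fun x hx => (S.hg_deriv i x hx).continuousWithinAt

lemma f_mem_dom {x : ℝ} (hx : x ∈ S.domF) : S.f x ∈ S.dom := by
  obtain ⟨i, u, hu, rfl⟩ := mem_iUnion.1 hx
  rwa [S.hf i u hu]

lemma fder_ne_zero {x : ℝ} (hx : x ∈ S.domF) : S.fder x ≠ 0 := by
  obtain ⟨i, u, hu, rfl⟩ := mem_iUnion.1 hx
  rw [S.hfder i u hu]
  exact inv_ne_zero (S.hgder_ne i u hu)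

lemma continuousOn_f : ContinuousOn S.f S.domF := by
  rw [continuousOn_iff_isClosed]
  intro C hC
  refine ⟨⋃ i, S.g i '' (S.dom ∩ C), ?_, ?_⟩
  · refine isClosed_iUnion_of_finite fun i => IsCompact.isClosed ?_
    exact (S.isCompact_dom.inter_right hC).image_of_continuousOn
      ((S.continuousOn_g i).mono inter_subset_left)
  · ext x
    constructor
    · rintro ⟨hxC, hx⟩
      refine ⟨?_, hx⟩
      obtain ⟨i, u, hu, rfl⟩ := mem_iUnion.1 hx
      rw [mem_preimage, S.hf i u hu] at hxC
      exact mem_iUnion.2 ⟨i, u, ⟨hu, hxC⟩, rfl⟩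
    · rintro ⟨hx, hx'⟩
      refine ⟨?_, hx'⟩
      obtain ⟨i, u, ⟨hu, huC⟩, rfl⟩ := mem_iUnion.1 hx
      rwa [mem_preimage, S.hf i u hu]

/-- Near a point of the range of `g i`, the map `f` is the inverse branch of `g i`. -/
lemma mem_image_of_mem_domF {i : Fin p} {z : ℝ} (hz : z ∈ S.domF) (hzi : z ∈ S.Isub i) :
    z ∈ S.g i '' S.dom := by
  obtain ⟨k, u, hu, rfl⟩ := mem_iUnion.1 hz
  by_cases hk : k = i
  · exact hk ▸ ⟨u, hu, rfl⟩
  · exact absurd hzi (disjoint_left.1 (S.hdisj k i hk)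
      (interior_subset (S.hg_range k ⟨u, hu, rfl⟩)))

lemma g_f_of_mem {i : Fin p} {z : ℝ} (hz : z ∈ S.domF) (hzi : z ∈ S.Isub i) :
    S.g i (S.f z) = z := by
  obtain ⟨u, hu, rfl⟩ := S.mem_image_of_mem_domF hz hzi
  rw [S.hf i u hu]

lemma hasDerivWithinAt_f {z : ℝ} (hz : z ∈ S.domF) :
    HasDerivWithinAt S.f (S.fder z) S.domF z := by
  obtain ⟨i, u, hu, rfl⟩ := mem_iUnion.1 hz
  have hint : S.g i u ∈ interior (S.Isub i) := S.hg_range i ⟨u, hu, rfl⟩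
  rw [S.hfder i u hu]
  have ht : Tendsto S.f (nhdsWithin (S.g i u) S.domF) (nhdsWithin (S.f (S.g i u)) S.dom) :=
    (S.continuousOn_f _ hz).tendsto_nhdsWithin fun x hx => S.f_mem_dom hx
  have hd : HasDerivWithinAt (S.g i) (S.gder i u) S.dom (S.f (S.g i u)) := by
    rw [S.hf i u hu]
    exact S.hg_deriv i u hu
  have hd' : HasFDerivWithinAt (S.g i)
      (ContinuousLinearEquiv.unitsEquivAut ℝ (Units.mk0 _ (S.hgder_ne i u hu)) : ℝ →L[ℝ] ℝ)
      S.dom (S.f (S.g i u)) := by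
    refine hd.hasFDerivWithinAt.congr_fderiv ?_
    ext
    simp
  refine (hd'.of_local_left_inverse ht hz ?_).hasDerivWithinAt.congr_deriv (by simp)
  filter_upwards [self_mem_nhdsWithin,
    mem_nhdsWithin_of_mem_nhds (mem_interior_iff_mem_nhds.1 hint)] with x hx hx'
  exact S.g_f_of_mem hx hx'

lemma cyl_cons_subset (i : Fin p) (w : List (Fin p)) : S.cyl (i :: w) ⊆ S.Isub i := by
  induction w generalizing i with
  | nil => exact subset_rfl
  | cons k w ih =>
    rintro _ ⟨u, hu, rfl⟩
    exact interior_subset (S.hg_range i ⟨u, mem_iUnion.2 ⟨k, ih k hu⟩, rfl⟩)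

lemma wordOf_succ (ω : ℕ → Fin p) (n : ℕ) :
    wordOf ω (n + 1) = ω 0 :: wordOf (fun k => ω (k + 1)) n := by
  simp [wordOf, List.range_succ_eq_map, Function.comp_def]

lemma exists_coding {z : ℝ} {ω : ℕ → Fin p} (hz : ∀ n, z ∈ S.cyl (wordOf ω n)) :
    z ∈ S.domF ∧ z ∈ S.Isub (ω 0) ∧ ∀ n, S.f z ∈ S.cyl (wordOf (fun k => ω (k + 1)) n) := by
  have key : ∀ n, ∃ u ∈ S.cyl (wordOf (fun k => ω (k + 1)) (n + 1)), S.g (ω 0) u = z := by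
    intro n
    have h := hz (n + 2)
    rw [wordOf_succ, wordOf_succ] at h
    rw [wordOf_succ]
    exact h
  have hdom : ∀ n u, u ∈ S.cyl (wordOf (fun k => ω (k + 1)) (n + 1)) → u ∈ S.Isub (ω 1) := by
    intro n u hu
    rw [wordOf_succ] at hu
    exact S.cyl_cons_subset _ _ hu
  have hf : ∀ n, S.f z ∈ S.cyl (wordOf (fun k => ω (k + 1)) (n + 1)) := by
    intro n
    obtain ⟨u, hu, rfl⟩ := key n
    rwa [S.hf _ u (mem_iUnion.2 ⟨_, hdom n u hu⟩)]
  refine ⟨?_, ?_, fun n => ?_⟩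
  · obtain ⟨u, hu, rfl⟩ := key 0
    exact mem_iUnion.2 ⟨_, u, mem_iUnion.2 ⟨_, hdom 0 u hu⟩, rfl⟩
  · have h := hz 1
    rw [wordOf_succ] at h
    exact S.cyl_cons_subset _ _ h
  · cases n with
    | zero => exact S.hsubI _ (hdom 0 _ (hf 0))
    | succ n => exact hf n

lemma f_mem_limitSet {z : ℝ} (hz : z ∈ S.limitSet) : S.f z ∈ S.limitSet := by
  obtain ⟨ω, hω, h⟩ := hz
  refine ⟨fun k => ω (k + 1), fun w hw n hc => hω w hw (n + 1) fun k hk => ?_,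
    (S.exists_coding h).2.2⟩
  rw [← hc k hk]
  congr 1
  omega

lemma iterate_mem_limitSet {z : ℝ} (hz : z ∈ S.limitSet) (n : ℕ) : S.f^[n] z ∈ S.limitSet := by
  induction n with
  | zero => exact hz
  | succ n ih =>
    rw [Function.iterate_succ_apply']
    exact S.f_mem_limitSet ih

lemma limitSet_subset_domF : S.limitSet ⊆ S.domF := by
  rintro z ⟨ω, -, h⟩
  exact (S.exists_coding h).1

/-- On a small ball around a point of the limit set, `f` is defined and `log |f'|` is Lipschitz. -/
lemma exists_ball_lipschitz {z : ℝ} (hz : z ∈ S.limitSet) :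
    ∃ ε > 0, ∃ L ≥ 0, ball z ε ⊆ S.domF ∧ ∀ a ∈ ball z ε, ∀ b ∈ ball z ε,
      |Real.log |S.fder a| - (Real.log |S.fder b|)| ≤ L * |a - b| := by
  obtain ⟨ω, -, h⟩ := hz
  obtain ⟨hzF, hzI, hcod⟩ := S.exists_coding h
  obtain ⟨hfF, hfI, -⟩ := S.exists_coding hcod
  set i := ω 0
  set k := ω (0 + 1)
  have hgf : S.g i (S.f z) = z := S.g_f_of_mem hzF hzI
  have hfint : S.f z ∈ interior (S.Isub k) := S.hg_range k (S.mem_image_of_mem_domF hfF hfI)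
  have hdom : S.dom ∈ nhds (S.f z) :=
    mem_of_superset (mem_interior_iff_mem_nhds.1 hfint) (subset_iUnion S.Isub k)
  have hfdom : S.f z ∈ S.dom := mem_of_mem_nhds hdom
  have hstrict : HasStrictDerivAt (S.g i) (S.gder i (S.f z)) (S.f z) := by
    refine hasStrictDerivAt_of_hasDerivAt_of_continuousAt ?_
      ((S.hgder_cont i).continuousAt hdom)
    filter_upwards [eventually_mem_nhds_iff.2 hdom] with u hu
    exact (S.hg_deriv i u (mem_of_mem_nhds hu)).hasDerivAt hu
  have himage : S.g i '' S.dom ∈ nhds z := by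
    have := hstrict.map_nhds_eq (S.hgder_ne i _ hfdom)
    rw [hgf] at this
    rw [← this]
    exact image_mem_map hdom
  have hdomF : S.domF ∈ nhds z :=
    mem_of_superset himage (subset_iUnion (fun i => S.g i '' S.dom) i)
  have hfstrict : HasStrictDerivAt S.f (S.gder i (S.f z))⁻¹ z := by
    refine HasStrictDerivAt.of_local_left_inverse (S.continuousOn_f.continuousAt hdomF) hstrict
      (S.hgder_ne i _ hfdom) ?_
    filter_upwards [himage] with a ha
    obtain ⟨u, hu, rfl⟩ := ha
    rw [S.hf i u hu]
  obtain ⟨K, s, hs, hK⟩ := hfstrict.hasStrictFDerivAt.exists_lipschitzOnWith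
  obtain ⟨θ, hθ⟩ := S.hgder_lip i
  obtain ⟨ε, hε, hball⟩ := Metric.mem_nhds_iff.1 (inter_mem himage hs)
  refine ⟨ε, hε, |θ| * K, by positivity, fun a ha =>
    mem_iUnion.2 ⟨i, (hball ha).1⟩, fun a ha b hb => ?_⟩
  have hLip := hK.dist_le_mul a (hball ha).2 b (hball hb).2
  obtain ⟨u, hu, rfl⟩ := (hball ha).1
  obtain ⟨v, hv, rfl⟩ := (hball hb).1
  rw [S.hf i u hu, S.hf i v hv, Real.dist_eq, Real.dist_eq] at hLip
  rw [S.hfder i u hu, S.hfder i v hv, abs_inv, abs_inv, Real.log_inv, Real.log_inv]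
  calc |-Real.log |S.gder i u| - (-Real.log |S.gder i v|)|
      = |Real.log |S.gder i u| - (Real.log |S.gder i v|)| := by
        rw [← abs_neg]; congr 1; ring
    _ ≤ θ * |u - v| := hθ u hu v hv
    _ ≤ |θ| * |u - v| := by gcongr; exact le_abs_self θ
    _ ≤ |θ| * (K * |S.g i u - S.g i v|) := by gcongr
    _ = |θ| * K * |S.g i u - S.g i v| := by ring

lemma derIter_add (a b : ℕ) (z : ℝ) :
    S.derIter (a + b) z = S.derIter a z * S.derIter b (S.f^[a] z) := by
  simp only [derIter, Finset.prod_range_add]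
  congr 1
  refine Finset.prod_congr rfl fun k _ => ?_
  rw [add_comm a k, Function.iterate_add_apply]

lemma derIter_succ (n : ℕ) (z : ℝ) :
    S.derIter (n + 1) z = S.derIter n z * S.fder (S.f^[n] z) :=
  Finset.prod_range_succ _ _

lemma derIter_ne_zero {n : ℕ} {z : ℝ} (h : ∀ k < n, S.f^[k] z ∈ S.domF) :
    S.derIter n z ≠ 0 :=
  Finset.prod_ne_zero_iff.2 fun k hk => S.fder_ne_zero (h k (Finset.mem_range.1 hk))

lemma derIter_ne_zero_of_mem_limitSet {z : ℝ} (hz : z ∈ S.limitSet) (n : ℕ) :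
    S.derIter n z ≠ 0 :=
  S.derIter_ne_zero fun k _ => S.limitSet_subset_domF (S.iterate_mem_limitSet hz k)

lemma hasDerivWithinAt_iterate {B : Set ℝ} {n : ℕ}
    (h : ∀ z ∈ B, ∀ k < n, S.f^[k] z ∈ S.domF) {z : ℝ} (hz : z ∈ B) :
    HasDerivWithinAt S.f^[n] (S.derIter n z) B z := by
  induction n with
  | zero => simpa [derIter] using hasDerivWithinAt_id z B
  | succ n ih =>
    have h1 := ih fun z hz k hk => h z hz k (by omega)
    have h2 := S.hasDerivWithinAt_f (h z hz n (by omega))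
    rw [Function.iterate_succ', S.derIter_succ, mul_comm]
    exact h2.comp z h1 fun w hw => h w hw n (by omega)

lemma abs_iterate_sub_le {B : Set ℝ} (hB : Convex ℝ B) {n : ℕ}
    (h : ∀ z ∈ B, ∀ k < n, S.f^[k] z ∈ S.domF) {C : ℝ} (hC : ∀ z ∈ B, |S.derIter n z| ≤ C)
    {a b : ℝ} (ha : a ∈ B) (hb : b ∈ B) :
    |S.f^[n] a - S.f^[n] b| ≤ C * |a - b| :=
  hB.norm_image_sub_le_of_norm_hasDerivWithin_le
    (fun _ hz => S.hasDerivWithinAt_iterate h hz) hC hb ha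

/-- The iterates of `f` along an orbit falling on a periodic orbit with `|λ| ≤ 1` have bounded
derivative. -/
lemma exists_abs_derIter_le {x : ℝ} {m : ℕ} (hm : 1 ≤ m) (hper : S.f^[m] x = x)
    (hle : |S.derIter m x| ≤ 1) {y : ℝ} {j : ℕ} (hj : S.f^[j] y = x) :
    ∃ M > 0, ∀ n ≥ j, |S.derIter n y| ≤ M := by
  have hx : ∀ s, |S.derIter s x| ≤ ∑ k ∈ Finset.range m, |S.derIter k x| := by
    intro s
    induction s using Nat.strong_induction_on with
    | _ s ih =>
      by_cases hs : s < m
      · exact Finset.single_le_sum (f := fun k => |S.derIter k x|) (fun _ _ => abs_nonneg _)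
          (Finset.mem_range.2 hs)
      · obtain ⟨t, rfl⟩ := Nat.exists_eq_add_of_le (not_lt.1 hs)
        rw [S.derIter_add, hper, abs_mul]
        exact (mul_le_of_le_one_left (abs_nonneg _) hle).trans (ih t (by omega))
  refine ⟨|S.derIter j y| * ∑ k ∈ Finset.range m, |S.derIter k x| + 1, by positivity, ?_⟩
  intro n hn
  obtain ⟨s, rfl⟩ := Nat.exists_eq_add_of_le hn
  rw [S.derIter_add, hj, abs_mul]
  have := mul_le_mul_of_nonneg_left (hx s) (abs_nonneg (S.derIter j y))
  linarith

lemma one_lt_abs_derIter_of_mem_hypSet {x : ℝ} {m : ℕ} (hm : 1 ≤ m) (hper : S.f^[m] x = x)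
    {y : ℝ} {j : ℕ} (hj : S.f^[j] y = x) (hy : y ∈ S.hypSet) : 1 < |S.derIter m x| := by
  by_contra hle
  obtain ⟨M, hM, hbound⟩ := S.exists_abs_derIter_le hm hper (not_lt.1 hle) hj
  obtain ⟨hyL, c₁, hc₁, c₂, hc₂, n, hn, r, hr, -, hr0, hk⟩ := hy
  have hdiam : ∀ k ≥ j, c₁ ≤ c₂ * M * (2 * r k) := by
    intro k hkj
    obtain ⟨hF, hd, hdist⟩ := hk k
    refine hd.le.trans (Metric.diam_le_of_forall_dist_le (by have := hr k; positivity) ?_)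
    rintro _ ⟨a, ha, rfl⟩ _ ⟨b, hb, rfl⟩
    have hyk := S.derIter_ne_zero_of_mem_limitSet hyL (n k)
    have hC : ∀ z ∈ ball y (r k), |S.derIter (n k) z| ≤ c₂ * M := by
      intro z hz
      have h1 := hdist z hz y (mem_ball_self (hr k))
      rw [div_lt_iff₀ (abs_pos.2 hyk)] at h1
      exact h1.le.trans (by gcongr; exact hbound _ (hkj.le.trans (hn.id_le k)))
    refine (S.abs_iterate_sub_le (convex_ball y (r k)) hF hC ha hb).trans ?_
    gcongr
    rw [mem_ball, Real.dist_eq] at ha hb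
    calc |a - b| ≤ |a - y| + |y - b| := abs_sub_le a y b
      _ ≤ 2 * r k := by rw [abs_sub_comm y b]; linarith
  have hlim : Tendsto (fun k => c₂ * M * (2 * r k)) atTop (nhds 0) := by
    simpa using (hr0.const_mul 2).const_mul (c₂ * M)
  exact absurd (ge_of_tendsto hlim (eventually_atTop.2 ⟨j, hdiam⟩)) (not_le.2 hc₁)

/-- Uniform version of `exists_ball_lipschitz` along an eventually periodic orbit. -/
lemma exists_uniform_ball_lipschitz {y : ℝ} (hy : y ∈ S.limitSet) {m j : ℕ} (hm : 1 ≤ m)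
    (hper : S.f^[m] (S.f^[j] y) = S.f^[j] y) :
    ∃ ε > 0, ∃ L ≥ 0, ∀ k, ball (S.f^[k] y) ε ⊆ S.domF ∧
      ∀ a ∈ ball (S.f^[k] y) ε, ∀ b ∈ ball (S.f^[k] y) ε,
        |Real.log |S.fder a| - (Real.log |S.fder b|)| ≤ L * |a - b| := by
  have hfin : ∀ N : ℕ, ∃ ε > 0, ∃ L ≥ 0, ∀ k < N, ball (S.f^[k] y) ε ⊆ S.domF ∧
      ∀ a ∈ ball (S.f^[k] y) ε, ∀ b ∈ ball (S.f^[k] y) ε,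
        |Real.log |S.fder a| - (Real.log |S.fder b|)| ≤ L * |a - b| := by
    intro N
    induction N with
    | zero => exact ⟨1, one_pos, 0, le_rfl, fun k hk => absurd hk (Nat.not_lt_zero k)⟩
    | succ N ih =>
      obtain ⟨ε, hε, L, hL, h⟩ := ih
      obtain ⟨ε', hε', L', hL', hF, hlip⟩ :=
        S.exists_ball_lipschitz (S.iterate_mem_limitSet hy N)
      refine ⟨min ε ε', lt_min hε hε', L + L', add_nonneg hL hL', fun k hk => ?_⟩
      rcases Nat.lt_succ_iff_lt_or_eq.1 hk with hk | rfl
      · have hsub : ball (S.f^[k] y) (min ε ε') ⊆ ball (S.f^[k] y) ε :=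
          ball_subset_ball (min_le_left _ _)
        refine ⟨hsub.trans (h k hk).1, fun a ha b hb =>
          ((h k hk).2 a (hsub ha) b (hsub hb)).trans ?_⟩
        gcongr
        linarith
      · have hsub : ball (S.f^[k] y) (min ε ε') ⊆ ball (S.f^[k] y) ε' :=
          ball_subset_ball (min_le_right _ _)
        refine ⟨hsub.trans hF, fun a ha b hb => (hlip a (hsub ha) b (hsub hb)).trans ?_⟩
        gcongr
        linarith
  obtain ⟨ε, hε, L, hL, h⟩ := hfin (j + m)
  refine ⟨ε, hε, L, hL, fun k => ?_⟩
  induction k using Nat.strong_induction_on with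
  | _ k ih =>
    by_cases hk : k < j + m
    · exact h k hk
    · obtain ⟨t, rfl⟩ := Nat.exists_eq_add_of_le (not_lt.1 hk)
      have heq : S.f^[j + m + t] y = S.f^[t + j] y := by
        rw [show j + m + t = t + (m + j) by ring, Function.iterate_add_apply,
          Function.iterate_add_apply, hper, Function.iterate_add_apply]
      rw [heq]
      exact ih (t + j) (by omega)

/-- Bounded distortion: if `f` is defined with `log |f'|` Lipschitz in uniform neighbourhoods of
the orbit of `y`, and the derivatives `|(f^k)'(y)|` are summable backwards from time `n`, then
`f^n` has distortion at most `2` with respect to `y` on a ball of radius comparable with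
`1 / |(f^n)'(y)|`. -/
lemma distortion_of_sum_le {y ε L ρ : ℝ} {n : ℕ} (hρ : 0 < ρ) (hL : 0 ≤ L)
    (hloc : ∀ k, ball (S.f^[k] y) ε ⊆ S.domF ∧
      ∀ a ∈ ball (S.f^[k] y) ε, ∀ b ∈ ball (S.f^[k] y) ε,
        |Real.log |S.fder a| - (Real.log |S.fder b|)| ≤ L * |a - b|)
    (hε : 2 * ρ * ∑ k ∈ Finset.range n, |S.derIter k y| < ε)
    (hlog : L * (2 * ρ * ∑ k ∈ Finset.range n, |S.derIter k y|) ≤ Real.log 2) :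
    ∀ i ≤ n, ∀ z ∈ ball y ρ, (∀ k < i, S.f^[k] z ∈ S.domF) ∧
      |S.f^[i] z - S.f^[i] y| ≤ 2 * ρ * |S.derIter i y| ∧
      |S.derIter i z| ≤ 2 * |S.derIter i y| ∧ |S.derIter i y| ≤ 2 * |S.derIter i z| := by
  intro i
  induction i using Nat.strong_induction_on with
  | _ i ih =>
  intro hi
  have hε0 : 0 < ε := lt_of_le_of_lt (by positivity) hε
  have hmem : ∀ z ∈ ball y ρ, ∀ k < i, S.f^[k] z ∈ ball (S.f^[k] y) ε := by
    intro z hz k hk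
    rw [mem_ball, Real.dist_eq]
    refine ((ih k hk (by omega) z hz).2.1.trans ?_).trans_lt hε
    gcongr
    exact Finset.single_le_sum (f := fun k => |S.derIter k y|) (fun _ _ => abs_nonneg _)
      (Finset.mem_range.2 (by omega))
  have hF : ∀ z ∈ ball y ρ, ∀ k < i, S.f^[k] z ∈ S.domF := fun z hz k hk =>
    (hloc k).1 (hmem z hz k hk)
  have hsum : ∀ z ∈ ball y ρ,
      |Real.log |S.derIter i z| - (Real.log |S.derIter i y|)| ≤ Real.log 2 := by
    intro z hz
    have hexp : ∀ w ∈ ball y ρ, Real.log |S.derIter i w| =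
        ∑ k ∈ Finset.range i, Real.log |S.fder (S.f^[k] w)| := by
      intro w hw
      rw [derIter, Finset.abs_prod, Real.log_prod]
      intro k hk
      exact abs_ne_zero.2 (S.fder_ne_zero (hF w hw k (Finset.mem_range.1 hk)))
    rw [hexp z hz, hexp y (mem_ball_self hρ), ← Finset.sum_sub_distrib]
    refine (Finset.abs_sum_le_sum_abs _ _).trans (le_trans ?_ hlog)
    rw [Finset.mul_sum, Finset.mul_sum]
    refine (Finset.sum_le_sum fun k hk => ?_).trans
      (Finset.sum_le_sum_of_subset_of_nonneg (Finset.range_mono hi)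
        fun k _ _ => by positivity)
    have hk' := Finset.mem_range.1 hk
    refine ((hloc k).2 _ (hmem z hz k hk') _ (mem_ball_self hε0)).trans ?_
    gcongr
    exact (ih k hk' (by omega) z hz).2.1
  have hpos : ∀ z ∈ ball y ρ, 0 < |S.derIter i z| := fun z hz =>
    abs_pos.2 (S.derIter_ne_zero (hF z hz))
  have hypos := hpos y (mem_ball_self hρ)
  have hupper : ∀ z ∈ ball y ρ, |S.derIter i z| ≤ 2 * |S.derIter i y| := by
    intro z hz
    rw [← Real.log_le_log_iff (hpos z hz) (by positivity),
      Real.log_mul two_ne_zero hypos.ne']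
    linarith [(abs_le.1 (hsum z hz)).2]
  intro z hz
  refine ⟨hF z hz, ?_, hupper z hz, ?_⟩
  · refine (S.abs_iterate_sub_le (convex_ball y ρ) hF hupper hz (mem_ball_self hρ)).trans ?_
    rw [mem_ball, Real.dist_eq] at hz
    calc 2 * |S.derIter i y| * |z - y| ≤ 2 * |S.derIter i y| * ρ := by gcongr
      _ = 2 * ρ * |S.derIter i y| := by ring
  · rw [← Real.log_le_log_iff hypos (by have := hpos z hz; positivity),
      Real.log_mul two_ne_zero (hpos z hz).ne']
    linarith [(abs_le.1 (hsum z hz)).1]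

lemma abs_derIter_add_mul {x y : ℝ} {m j : ℕ} (hper : S.f^[m] x = x) (hj : S.f^[j] y = x)
    (q : ℕ) :
    S.f^[j + q * m] y = x ∧
      |S.derIter (j + q * m) y| = |S.derIter j y| * |S.derIter m x| ^ q := by
  induction q with
  | zero => simpa using hj
  | succ q ih =>
    have h : j + (q + 1) * m = j + q * m + m := by ring
    refine ⟨?_, ?_⟩
    · rw [h, add_comm, Function.iterate_add_apply, ih.1, hper]
    · rw [h, S.derIter_add, ih.1, abs_mul, ih.2]
      ring

lemma exists_sum_derIter_le {x y : ℝ} {m j : ℕ} (hper : S.f^[m] x = x) (hj : S.f^[j] y = x)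
    (hy : S.derIter j y ≠ 0) (hlt : 1 < |S.derIter m x|) :
    ∃ K > 0, ∀ q, ∑ k ∈ Finset.range (j + q * m), |S.derIter k y| ≤
      K * |S.derIter (j + q * m) y| := by
  have hyp : 0 < |S.derIter j y| := abs_pos.2 hy
  have hl : 0 < |S.derIter m x| - 1 := by linarith
  set A := ∑ k ∈ Finset.range j, |S.derIter k y| with hA
  set c := ∑ s ∈ Finset.range m, |S.derIter s x| with hc
  have hA0 : 0 ≤ A := by positivity
  have hc0 : 0 ≤ c := by positivity
  set K := A / |S.derIter j y| + c / (|S.derIter m x| - 1) + 1 with hK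
  have hK0 : 0 < K := by positivity
  have hKA : A ≤ K * |S.derIter j y| := by
    rw [← div_le_iff₀ hyp, hK]
    have : 0 ≤ c / (|S.derIter m x| - 1) := by positivity
    linarith
  have hKc : c ≤ K * (|S.derIter m x| - 1) := by
    rw [← div_le_iff₀ hl, hK]
    have : 0 ≤ A / |S.derIter j y| := by positivity
    linarith
  refine ⟨K, hK0, fun q => ?_⟩
  induction q with
  | zero => simpa using hKA
  | succ q ih =>
    obtain ⟨hq, -⟩ := S.abs_derIter_add_mul hper hj q
    rw [show j + (q + 1) * m = j + q * m + m by ring, Finset.sum_range_add, S.derIter_add, hq]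
    simp only [S.derIter_add (j + q * m), hq, abs_mul]
    rw [← Finset.mul_sum, ← hc]
    have := mul_le_mul_of_nonneg_left hKc (abs_nonneg (S.derIter (j + q * m) y))
    linarith

lemma mem_hypSet_of_one_lt_abs_derIter {x : ℝ} {m : ℕ} (hm : 1 ≤ m) (hper : S.f^[m] x = x)
    {y : ℝ} {j : ℕ} (hy : y ∈ S.limitSet) (hj : S.f^[j] y = x) (hlt : 1 < |S.derIter m x|) :
    y ∈ S.hypSet := by
  have hD := S.derIter_ne_zero_of_mem_limitSet hy
  obtain ⟨ε, hε, L, hL, hloc⟩ := S.exists_uniform_ball_lipschitz hy (j := j) hm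
    (by rw [hj, hper])
  obtain ⟨K, hK, hsum⟩ := S.exists_sum_derIter_le hper hj (hD j) hlt
  have hlog2 : 0 < Real.log 2 := Real.log_pos one_lt_two
  obtain ⟨δ, hδ, hδε, hδL⟩ : ∃ δ > 0, 2 * δ * K < ε ∧ L * (2 * δ * K) ≤ Real.log 2 := by
    refine ⟨min (ε / (4 * K)) (Real.log 2 / (2 * K * (L + 1))), by positivity, ?_, ?_⟩
    · have := min_le_left (ε / (4 * K)) (Real.log 2 / (2 * K * (L + 1)))
      rw [le_div_iff₀ (by positivity)] at this
      linarith
    · have h1 := min_le_right (ε / (4 * K)) (Real.log 2 / (2 * K * (L + 1)))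
      have h0 : 0 < min (ε / (4 * K)) (Real.log 2 / (2 * K * (L + 1))) := by positivity
      rw [le_div_iff₀ (by positivity)] at h1
      have h2 := mul_pos h0 hK
      linarith
  have hDpos : ∀ n, 0 < |S.derIter n y| := fun n => abs_pos.2 (hD n)
  set r : ℕ → ℝ := fun q => δ / |S.derIter (j + q * m) y| with hr
  have hrpos : ∀ q, 0 < r q := fun q => div_pos hδ (hDpos _)
  have hrD : ∀ q, r q * |S.derIter (j + q * m) y| = δ := fun q =>
    div_mul_cancel₀ δ (hDpos _).ne'
  have hdist : ∀ q, _ := fun q => S.distortion_of_sum_le (n := j + q * m) (hrpos q)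
    (show 0 ≤ L from hL) hloc
    (by
      refine lt_of_le_of_lt ?_ hδε
      rw [← hrD q]
      have := mul_le_mul_of_nonneg_left (hsum q) (hrpos q).le
      linarith)
    (by
      refine le_trans (mul_le_mul_of_nonneg_left ?_ hL) hδL
      rw [← hrD q]
      have := mul_le_mul_of_nonneg_left (hsum q) (hrpos q).le
      linarith) (j + q * m) le_rfl
  have hpow : ∀ q, r q = δ / |S.derIter j y| * (|S.derIter m x|⁻¹) ^ q := by
    intro q
    simp only [hr, (S.abs_derIter_add_mul hper hj q).2]
    rw [inv_pow, div_mul_eq_div_div, div_eq_mul_inv (δ / |S.derIter j y|)]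
  have hinv : |S.derIter m x|⁻¹ < 1 := inv_lt_one_of_one_lt₀ hlt
  refine ⟨hy, δ / 8, by positivity, 5, by norm_num, fun q => j + q * m, ?_, r, hrpos, ?_, ?_, ?_⟩
  · intro a b hab
    have := Nat.mul_lt_mul_of_pos_right hab hm
    simpa using this
  · intro a b hab
    rw [hpow, hpow]
    exact mul_le_mul_of_nonneg_left (pow_le_pow_of_le_one (by positivity) hinv.le hab)
      (by have := hDpos j; positivity)
  · rw [show r = _ from funext hpow]
    simpa using (tendsto_pow_atTop_nhds_zero_of_lt_one (by positivity) hinv).const_mul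
      (δ / |S.derIter j y|)
  · intro q
    have hF : ∀ z ∈ ball y (r q), ∀ k < j + q * m, S.f^[k] z ∈ S.domF := fun z hz =>
      (hdist q z hz).1
    have hcen : y ∈ ball y (r q) := mem_ball_self (hrpos q)
    refine ⟨hF, ?_, ?_⟩
    · have hz : y + r q / 2 ∈ ball y (r q) := by
        rw [mem_ball, Real.dist_eq, add_sub_cancel_left, abs_of_pos (half_pos (hrpos q))]
        exact half_lt_self (hrpos q)
      have hsub : Icc y (y + r q / 2) ⊆ ball y (r q) :=
        (convex_ball y (r q)).ordConnected.out hcen hz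
      have hder : ∀ w ∈ ball y (r q),
          HasDerivAt S.f^[j + q * m] (S.derIter (j + q * m) w) w := fun w hw =>
        (S.hasDerivWithinAt_iterate hF hw).hasDerivAt (isOpen_ball.mem_nhds hw)
      obtain ⟨w, hw, hslope⟩ := exists_hasDerivAt_eq_slope S.f^[j + q * m]
        (S.derIter (j + q * m)) (lt_add_of_pos_right y (half_pos (hrpos q)))
        (fun w hw => (hder w (hsub hw)).continuousAt.continuousWithinAt)
        (fun w hw => hder w (hsub (Ioo_subset_Icc_self hw)))
      have hwlow := (hdist q w (hsub (Ioo_subset_Icc_self hw))).2.2.2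
      rw [add_sub_cancel_left, eq_div_iff (half_pos (hrpos q)).ne'] at hslope
      have hbdd : Bornology.IsBounded (S.f^[j + q * m] '' ball y (r q)) := by
        refine (isBounded_closedBall (x := S.f^[j + q * m] y)
          (r := 2 * r q * |S.derIter (j + q * m) y|)).subset ?_
        rintro _ ⟨z, hz, rfl⟩
        exact (hdist q z hz).2.1
      refine lt_of_lt_of_le ?_ (Metric.dist_le_diam_of_mem hbdd (mem_image_of_mem _ hz)
        (mem_image_of_mem _ hcen))
      rw [Real.dist_eq, ← hslope, abs_mul, abs_of_pos (half_pos (hrpos q))]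
      have h1 := mul_le_mul_of_nonneg_left hwlow (hrpos q).le
      rw [hrD q] at h1
      linarith
    · intro a ha b hb
      have h1 := (hdist q a ha).2.2.1
      have h2 := (hdist q b hb).2.2.2
      have hb0 : 0 < |S.derIter (j + q * m) b| := abs_pos.2 (S.derIter_ne_zero (hF b hb))
      rw [div_lt_iff₀ hb0]
      linarith

end ExpansiveMarkovSystem

/-- Let `x ∈ Λ_Q` be periodic with `f^m(x) = x` and let `y ∈ Λ_Q` satisfy
`f^j(y) = x` for some `j ≥ 0`. Then `y ∈ H` iff `|(f^m)'(x)| > 1`. -/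
theorem preimage_of_periodic_mem_hypSet_iff {p : ℕ} (S : ExpansiveMarkovSystem p)
    (x : ℝ) (hx : x ∈ S.limitSet) (m : ℕ) (hm : 1 ≤ m) (hper : S.f^[m] x = x)
    (y : ℝ) (hy : y ∈ S.limitSet) (j : ℕ) (hj : S.f^[j] y = x) :
    y ∈ S.hypSet ↔ 1 < |S.derIter m x| := by
  exact ⟨S.one_lt_abs_derIter_of_mem_hypSet hm hper hj,
    S.mem_hypSet_of_one_lt_abs_derIter hm hper hy hj⟩
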